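/- arXiv:math/0212320 — 6 statements merged into one kernel-verified Lean document; each statement's English description precedes it below -/
import Mathlib

section
/- The map ζ : H → B defined by ζ(g) = Σ ι(g₍₁₎) · j(f(S g₍₂₎)) is a homomorphism of unital k-algebras. -/
/-!
Context: `H` is a Hopf algebra over a field `k`, `A` is a right `H`-module algebra,
`B` is a model of the cross product `A ⋊ H`, `f : H → A` is a realization of `H` in `A`,
and `ζ : H → B` is defined by `ζ(g) = Σ ι(g₍₁₎) · j(f(S g₍₂₎))`.
-/

open TensorProduct

/-- A right module-algebra action of a Hopf algebra `H` on a unital associative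
`k`-algebra `A`: a `k`-bilinear map `◁ : A × H → A` (curried as `act`) such that
`a ◁ (g g') = (a ◁ g) ◁ g'`, `a ◁ 1 = a`,
`(a a') ◁ g = Σ (a ◁ g₍₁₎)(a' ◁ g₍₂₎)` and `1 ◁ g = ε(g) 1`. -/
structure RightModuleAlgebra (k H A : Type*) [CommRing k] [Ring H] [Ring A]
    [HopfAlgebra k H] [Algebra k A] where
  act : A →ₗ[k] H →ₗ[k] A
  act_mul : ∀ (a : A) (g g' : H), act a (g * g') = act (act a g) g'
  act_one : ∀ a : A, act a 1 = a
  mul_act : ∀ (a a' : A) (g : H),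
    act (a * a') g =
      LinearMap.mul' k A (TensorProduct.map (act a) (act a') (Coalgebra.comul (R := k) g))
  one_act : ∀ g : H, act 1 g = algebraMap k A (Coalgebra.counit (R := k) g)

/-- A model of the cross product algebra `A ⋊ H`: a unital associative `k`-algebra `B`
with algebra maps `j : A → B`, `ι : H → B` such that `g ⊗ a ↦ ι(g) j(a)` is a linear
isomorphism `H ⊗ₖ A ≃ B` and `j(a) ι(g) = Σ ι(g₍₁₎) j(a ◁ g₍₂₎)`. -/
structure CrossProductModel (k H A B : Type*) [CommRing k] [Ring H] [Ring A] [Ring B]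
    [HopfAlgebra k H] [Algebra k A] [Algebra k B]
    (ma : RightModuleAlgebra k H A) where
  j : A →ₐ[k] B
  ι : H →ₐ[k] B
  mul_bij : Function.Bijective
    ((LinearMap.mul' k B) ∘ₗ (TensorProduct.map ι.toLinearMap j.toLinearMap))
  straighten : ∀ (a : A) (g : H),
    j a * ι g =
      LinearMap.mul' k B
        (TensorProduct.map ι.toLinearMap (j.toLinearMap ∘ₗ ma.act a)
          (Coalgebra.comul (R := k) g))

/-- A realization of `H` in `A`: an algebra homomorphism `f : H → A` such that
`a · f(g) = Σ f(g₍₁₎) · (a ◁ g₍₂₎)` for all `a ∈ A`, `g ∈ H`. -/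
def IsRealization {k H A : Type*} [CommRing k] [Ring H] [Ring A]
    [HopfAlgebra k H] [Algebra k A]
    (ma : RightModuleAlgebra k H A) (f : H →ₐ[k] A) : Prop :=
  ∀ (a : A) (g : H),
    a * f g =
      LinearMap.mul' k A
        (TensorProduct.map f.toLinearMap (ma.act a) (Coalgebra.comul (R := k) g))

/-- The map `ζ : H → B`, `ζ(g) = Σ ι(g₍₁₎) · j(f(S g₍₂₎))`. -/
noncomputable def zeta {k H A B : Type*} [CommRing k] [Ring H] [Ring A] [Ring B]
    [HopfAlgebra k H] [Algebra k A] [Algebra k B]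
    {ma : RightModuleAlgebra k H A} (cp : CrossProductModel k H A B ma)
    (f : H →ₐ[k] A) : H →ₗ[k] B :=
  LinearMap.mul' k B ∘ₗ
    TensorProduct.map cp.ι.toLinearMap
      (cp.j.toLinearMap ∘ₗ f.toLinearMap ∘ₗ (HopfAlgebra.antipode (R := k) (A := H))) ∘ₗ
    Coalgebra.comul (R := k)

section ConvConst

open Coalgebra WithConv

variable {k H A B : Type*} [CommRing k] [Ring H] [HopfAlgebra k H] [Ring A] [Algebra k A]
  [Ring B] [Algebra k B]

/-- The convolution element `h ↦ ε(h) a`. -/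
noncomputable def convConst (k H : Type*) {A : Type*} [CommRing k] [Ring H] [HopfAlgebra k H]
    [Ring A] [Algebra k A] (a : A) : WithConv (H →ₗ[k] A) :=
  toConv (LinearMap.toSpanSingleton k A a ∘ₗ counit)

lemma convConst_mul_apply (a : A) (φ : WithConv (H →ₗ[k] A)) (h : H) :
    (convConst k H a * φ) h = a * φ h := by
  rw [(ℛ k h).convMul_apply]
  conv_rhs => rw [← sum_counit_smul (ℛ k h)]
  simp [convConst, Finset.mul_sum]

lemma mul_convConst_apply (a : A) (φ : WithConv (H →ₗ[k] A)) (h : H) :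
    (φ * convConst k H a) h = φ h * a := by
  have key : ∑ i ∈ (ℛ k h).index, counit (R := k) ((ℛ k h).right i) • (ℛ k h).left i = h := by
    simpa only [map_sum, TensorProduct.rid_tmul, one_smul] using
      congr(TensorProduct.rid k H $(sum_tmul_counit_eq (R := k) (ℛ k h)))
  rw [(ℛ k h).convMul_apply]
  conv_rhs => rw [← key]
  simp [convConst, Finset.sum_mul]

lemma comp_antipode_convMul (f : H →ₐ[k] A) :
    toConv (f.toLinearMap ∘ₗ HopfAlgebra.antipode k) * toConv f.toLinearMap = 1 := by
  have := LinearMap.algHom_comp_convMul_distrib f (toConv (HopfAlgebra.antipode k (A := H)))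
    (toConv LinearMap.id)
  rw [LinearMap.antipode_mul_id] at this
  refine WithConv.ext (this.symm.trans ?_)
  ext h
  simp [LinearMap.convOne_def]

lemma convMul_comp_antipode (f : H →ₐ[k] A) :
    toConv f.toLinearMap * toConv (f.toLinearMap ∘ₗ HopfAlgebra.antipode k) = 1 := by
  have := LinearMap.algHom_comp_convMul_distrib f (toConv LinearMap.id)
    (toConv (HopfAlgebra.antipode k (A := H)))
  rw [LinearMap.id_mul_antipode] at this
  refine WithConv.ext (this.symm.trans ?_)
  ext h
  simp [LinearMap.convOne_def]

variable {ma : RightModuleAlgebra k H A}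

lemma IsRealization.act_convMul_comp_antipode {f : H →ₐ[k] A} (hf : IsRealization ma f) (a : A) :
    toConv (ma.act a) * toConv (f.toLinearMap ∘ₗ HopfAlgebra.antipode k) =
      toConv (f.toLinearMap ∘ₗ HopfAlgebra.antipode k) * convConst k H a := by
  have hconv : convConst k H a * toConv f.toLinearMap =
      toConv f.toLinearMap * toConv (ma.act a) := by
    ext h
    rw [convConst_mul_apply]
    exact hf a h
  calc
    _ = toConv (f.toLinearMap ∘ₗ HopfAlgebra.antipode k) *
          (toConv f.toLinearMap * toConv (ma.act a)) *
          toConv (f.toLinearMap ∘ₗ HopfAlgebra.antipode k) := by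
      rw [← mul_assoc, comp_antipode_convMul, one_mul]
    _ = _ := by
      rw [← hconv, mul_assoc, mul_assoc, convMul_comp_antipode, mul_one]

/-- The image of `ζ` commutes with the image of `A` in the cross product. -/
lemma IsRealization.commute_j_zeta {f : H →ₐ[k] A} (hf : IsRealization ma f)
    (cp : CrossProductModel k H A B ma) (a : A) (g : H) :
    Commute (cp.j a) (zeta cp f g) := by
  have hstraighten : convConst k H (cp.j a) * toConv cp.ι.toLinearMap =
      toConv cp.ι.toLinearMap * toConv (cp.j.toLinearMap ∘ₗ ma.act a) := by
    ext h
    rw [convConst_mul_apply]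
    exact cp.straighten a h
  have hconst : cp.j.toLinearMap ∘ₗ (convConst k H a).ofConv =
      (convConst k H (cp.j a)).ofConv := by
    ext h
    simp [convConst]
  have hact : toConv (cp.j.toLinearMap ∘ₗ ma.act a) *
        toConv (cp.j.toLinearMap ∘ₗ f.toLinearMap ∘ₗ HopfAlgebra.antipode k) =
      toConv (cp.j.toLinearMap ∘ₗ f.toLinearMap ∘ₗ HopfAlgebra.antipode k) *
        convConst k H (cp.j a) := by
    have h := congr(cp.j.toLinearMap ∘ₗ ($(hf.act_convMul_comp_antipode a)).ofConv)
    rw [LinearMap.algHom_comp_convMul_distrib, LinearMap.algHom_comp_convMul_distrib, hconst] at h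
    exact WithConv.ext h
  have hzeta : toConv (zeta cp f) = toConv cp.ι.toLinearMap *
      toConv (cp.j.toLinearMap ∘ₗ f.toLinearMap ∘ₗ HopfAlgebra.antipode k) := rfl
  have hcomm : convConst k H (cp.j a) * toConv (zeta cp f) =
      toConv (zeta cp f) * convConst k H (cp.j a) := by
    rw [hzeta, ← mul_assoc, hstraighten, mul_assoc, hact, mul_assoc]
  have h := congr($hcomm g)
  rwa [convConst_mul_apply, mul_convConst_apply] at h

lemma zeta_eq_sum (cp : CrossProductModel k H A B ma) (f : H →ₐ[k] A) {g : H} {κ : Type*}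
    (r : Repr k g κ) :
    zeta cp f g =
      ∑ i ∈ r.index, cp.ι (r.left i) * cp.j (f (HopfAlgebra.antipode k (r.right i))) := by
  simp [zeta, ← r.eq]

end ConvConst

/-- `ζ` is a homomorphism of unital `k`-algebras (it is `k`-linear by
construction, preserves the unit and preserves multiplication). -/
theorem zeta_isAlgHom {k H A B : Type*} [Field k] [Ring H] [Ring A] [Ring B]
    [HopfAlgebra k H] [Algebra k A] [Algebra k B]
    (ma : RightModuleAlgebra k H A) (cp : CrossProductModel k H A B ma)
    (f : H →ₐ[k] A) (hf : IsRealization ma f) :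
    zeta cp f 1 = 1 ∧ ∀ g g' : H, zeta cp f (g * g') = zeta cp f g * zeta cp f g' := by
  open Coalgebra in
  refine ⟨by simp [zeta, Algebra.TensorProduct.one_def], fun g g' => ?_⟩
  rw [zeta_eq_sum cp f ((ℛ k g).mul (ℛ k g')), zeta_eq_sum cp f (ℛ k g), Finset.sum_mul]
  simp_rw [mul_assoc, (hf.commute_j_zeta cp _ g').eq, zeta_eq_sum cp f (ℛ k g')]
  simp [Finset.sum_product, Finset.sum_mul, Finset.mul_sum, HopfAlgebra.antipode_mul_antidistrib,
    mul_assoc]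
end

section
/- The k-linear map H ⊗ₖ A → B sending g ⊗ a to ζ(g) · j(a) is a linear isomorphism; in particular every element of B is a finite sum Σᵢ ζ(gᵢ) j(aᵢ) with gᵢ ∈ H, aᵢ ∈ A, i.e. B = ζ(H) · j(A). -/
/-!
Context: `H` is a Hopf algebra over a field `k`, `A` is a right `H`-module algebra,
`B` is a model of the cross product `A ⋊ H`, `f : H → A` is a realization of `H` in `A`,
and `ζ : H → B` is defined by `ζ(g) = Σ ι(g₍₁₎) · j(f(S g₍₂₎))`.
-/

open TensorProduct

/-- The endomorphism `g ⊗ a ↦ Σ g₍₁₎ ⊗ u(g₍₂₎) a` of `H ⊗ A` attached to a linear map `u : H → A`. -/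
noncomputable def comulTwist {k H A : Type*} [CommRing k] [AddCommGroup H] [Module k H]
    [Coalgebra k H] [Ring A] [Algebra k A] (u : H →ₗ[k] A) : H ⊗[k] A →ₗ[k] H ⊗[k] A :=
  TensorProduct.map LinearMap.id (LinearMap.mul' k A) ∘ₗ
    (TensorProduct.assoc k H A A).toLinearMap ∘ₗ
      TensorProduct.map (TensorProduct.map LinearMap.id u ∘ₗ Coalgebra.comul) LinearMap.id

section

variable {k H A : Type*} [CommRing k]

section Coalgebra

variable [AddCommGroup H] [Module k H] [Coalgebra k H] [Ring A] [Algebra k A]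

theorem comulTwist_tmul (u : H →ₗ[k] A) (g : H) (a : A) :
    comulTwist u (g ⊗ₜ[k] a) =
      TensorProduct.map LinearMap.id (LinearMap.mulRight k a ∘ₗ u)
        (Coalgebra.comul (R := k) g) := by
  simp only [comulTwist, LinearMap.comp_apply, TensorProduct.map_tmul, LinearMap.id_apply]
  induction Coalgebra.comul (R := k) g with
  | zero => simp
  | tmul x y => simp
  | add x y hx hy => simp only [map_add, TensorProduct.add_tmul, hx, hy]

theorem comulTwist_map (u v : H →ₗ[k] A) (a : A) (t : H ⊗[k] H) :
    comulTwist u (TensorProduct.map LinearMap.id (LinearMap.mulRight k a ∘ₗ v) t) =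
      TensorProduct.map LinearMap.id
        (LinearMap.mulRight k a ∘ₗ LinearMap.mul' k A ∘ₗ TensorProduct.map u v)
        (TensorProduct.assoc k H H H ((Coalgebra.comul (R := k)).rTensor H t)) := by
  induction t with
  | zero => simp
  | add x y hx hy => simp only [map_add, hx, hy]
  | tmul x y =>
    simp only [TensorProduct.map_tmul, comulTwist_tmul, LinearMap.rTensor_tmul]
    induction Coalgebra.comul (R := k) x with
    | zero => simp
    | tmul p q => simp [mul_assoc]
    | add p q hp hq => simp only [map_add, TensorProduct.add_tmul, hp, hq]

theorem comulTwist_comp (u v : H →ₗ[k] A) :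
    comulTwist u ∘ₗ comulTwist v =
      comulTwist (LinearMap.mul' k A ∘ₗ TensorProduct.map u v ∘ₗ Coalgebra.comul) := by
  ext g a
  simp only [TensorProduct.AlgebraTensorModule.curry_apply, TensorProduct.curry_apply,
    LinearMap.coe_restrictScalars, LinearMap.comp_apply]
  rw [comulTwist_tmul v, comulTwist_map, Coalgebra.coassoc_apply, comulTwist_tmul,
    LinearMap.lTensor, ← LinearMap.comp_apply, ← TensorProduct.map_comp]
  rfl

theorem comulTwist_counit :
    comulTwist (Algebra.linearMap k A ∘ₗ Coalgebra.counit (A := H)) = LinearMap.id := by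
  ext g a
  have h : TensorProduct.map LinearMap.id
      (LinearMap.mulRight k a ∘ₗ Algebra.linearMap k A ∘ₗ Coalgebra.counit (A := H)) =
      (LinearMap.mulRight k a ∘ₗ Algebra.linearMap k A).lTensor H ∘ₗ
        (Coalgebra.counit (R := k) (A := H)).lTensor H := by
    rw [← LinearMap.lTensor_comp]; rfl
  simp only [TensorProduct.AlgebraTensorModule.curry_apply, TensorProduct.curry_apply,
    LinearMap.coe_restrictScalars, LinearMap.id_apply]
  rw [comulTwist_tmul, h, LinearMap.comp_apply, Coalgebra.lTensor_counit_comul]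
  simp

end Coalgebra

section HopfAlgebra

variable [Ring H] [HopfAlgebra k H] [Ring A] [Algebra k A]

theorem comulTwist_antipode_comp (f : H →ₐ[k] A) :
    comulTwist (f.toLinearMap ∘ₗ HopfAlgebra.antipode k (A := H)) ∘ₗ
      comulTwist f.toLinearMap = LinearMap.id := by
  rw [comulTwist_comp, ← comulTwist_counit]
  congr 1
  ext g
  have h := congrArg f (HopfAlgebra.mul_antipode_rTensor_comul_apply (R := k) g)
  rw [AlgHom.commutes] at h
  simp only [LinearMap.comp_apply, Algebra.linearMap_apply, ← h]
  induction Coalgebra.comul (R := k) g with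
  | zero => simp
  | tmul x y => simp
  | add x y hx hy => simp only [map_add, hx, hy]

theorem comulTwist_comp_antipode (f : H →ₐ[k] A) :
    comulTwist f.toLinearMap ∘ₗ
      comulTwist (f.toLinearMap ∘ₗ HopfAlgebra.antipode k (A := H)) = LinearMap.id := by
  rw [comulTwist_comp, ← comulTwist_counit]
  congr 1
  ext g
  have h := congrArg f (HopfAlgebra.mul_antipode_lTensor_comul_apply (R := k) g)
  rw [AlgHom.commutes] at h
  simp only [LinearMap.comp_apply, Algebra.linearMap_apply, ← h]
  induction Coalgebra.comul (R := k) g with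
  | zero => simp
  | tmul x y => simp
  | add x y hx hy => simp only [map_add, hx, hy]

theorem mul'_map_zeta {B : Type*} [Ring B] [Algebra k B] {ma : RightModuleAlgebra k H A}
    (cp : CrossProductModel k H A B ma) (f : H →ₐ[k] A) :
    LinearMap.mul' k B ∘ₗ TensorProduct.map (zeta cp f) cp.j.toLinearMap =
      (LinearMap.mul' k B ∘ₗ TensorProduct.map cp.ι.toLinearMap cp.j.toLinearMap) ∘ₗ
        comulTwist (f.toLinearMap ∘ₗ HopfAlgebra.antipode k (A := H)) := by
  ext g a
  simp only [TensorProduct.AlgebraTensorModule.curry_apply, TensorProduct.curry_apply,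
    LinearMap.coe_restrictScalars, LinearMap.comp_apply, comulTwist_tmul, TensorProduct.map_tmul,
    zeta, LinearMap.mul'_apply]
  induction Coalgebra.comul (R := k) g with
  | zero => simp
  | tmul x y => simp [mul_assoc]
  | add x y hx hy => simp only [map_add, add_mul, hx, hy]

end HopfAlgebra

end

/-- the `k`-linear map `H ⊗ₖ A → B`, `g ⊗ a ↦ ζ(g) · j(a)`, is a linear
isomorphism; in particular every element of `B` is a finite sum `Σᵢ ζ(gᵢ) j(aᵢ)`, i.e.
`B = ζ(H) · j(A)`. -/
theorem zeta_mul_j_bijective {k H A B : Type*} [Field k] [Ring H] [Ring A] [Ring B]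
    [HopfAlgebra k H] [Algebra k A] [Algebra k B]
    (ma : RightModuleAlgebra k H A) (cp : CrossProductModel k H A B ma)
    (f : H →ₐ[k] A) (hf : IsRealization ma f) :
    Function.Bijective
        ((LinearMap.mul' k B) ∘ₗ (TensorProduct.map (zeta cp f) cp.j.toLinearMap)) ∧
      ∀ b : B, b ∈ Submodule.span k {x : B | ∃ (g : H) (a : A), x = zeta cp f g * cp.j a} := by
  have hbij : Function.Bijective
      ((LinearMap.mul' k B) ∘ₗ (TensorProduct.map (zeta cp f) cp.j.toLinearMap)) := by
    rw [mul'_map_zeta, LinearMap.coe_comp]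
    refine cp.mul_bij.comp (Function.bijective_iff_has_inverse.mpr
      ⟨comulTwist f.toLinearMap, fun t ↦ ?_, fun t ↦ ?_⟩)
    · exact LinearMap.congr_fun (comulTwist_comp_antipode f) t
    · exact LinearMap.congr_fun (comulTwist_antipode_comp f) t
  refine ⟨hbij, fun b ↦ ?_⟩
  obtain ⟨t, rfl⟩ := hbij.surjective b
  induction t with
  | zero => simp
  | tmul g a => exact Submodule.subset_span ⟨g, a, by simp⟩
  | add x y hx hy => rw [map_add]; exact Submodule.add_mem _ hx hy
end

section
/- If, in addition, H, A and B carry involutions * making them *-algebras, with Δ and ε *-homomorphisms on H, with (a ◁ g)* = a* ◁ (S g)* for all a ∈ A, g ∈ H, with j and ι *-homomorphisms, and if the realization f : H → A is a *-algebra homomorphism, then ζ : H → B is a *-algebra homomorphism, i.e. ζ(g*) = (ζ(g))* for all g ∈ H. -/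
/-!
Context: `H` is a Hopf algebra over a field `k`, `A` is a right `H`-module algebra,
`B` is a model of the cross product `A ⋊ H`, `f : H → A` is a realization of `H` in `A`,
and `ζ : H → B` is defined by `ζ(g) = Σ ι(g₍₁₎) · j(f(S g₍₂₎))`.
-/

open TensorProduct

/-- The componentwise star map `H ⊗ₖ H → H ⊗ₖ H`, `a ⊗ b ↦ a* ⊗ b*` (it is additive,
conjugate-linear over `k`). -/
noncomputable def starTensor (k H : Type*) [CommRing k] [StarRing k] [Ring H]
    [Algebra k H] [StarRing H] [StarModule k H] :
    H ⊗[k] H →+ H ⊗[k] H :=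
  TensorProduct.liftAddHom
    { toFun := fun a =>
        { toFun := fun b => star a ⊗ₜ[k] star b
          map_zero' := by simp
          map_add' := fun b b' => by simp [TensorProduct.tmul_add] }
      map_zero' := by ext b; simp
      map_add' := fun a a' => by ext b; simp [TensorProduct.add_tmul] }
    (by
      intro r a b
      simp only [AddMonoidHom.coe_mk, ZeroHom.coe_mk, star_smul, TensorProduct.smul_tmul,
        TensorProduct.tmul_smul])

open Coalgebra HopfAlgebra in
/-- Coassociativity, in the form `Σ F(h₁, h₂₁, h₂₂) = Σ F(h₁₁, h₁₂, h₂)`. -/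
lemma apply_comul_eq_of_coassoc {k H X : Type*} [CommRing k] [AddCommGroup H] [Module k H]
    [Coalgebra k H] [AddCommGroup X] [Module k X]
    (F : H ⊗[k] (H ⊗[k] H) →ₗ[k] X) (P Q : H ⊗[k] H →ₗ[k] X)
    (hP : ∀ x y, P (x ⊗ₜ y) = F (x ⊗ₜ comul y))
    (hQ : ∀ x z, Q (x ⊗ₜ z) = F (TensorProduct.assoc k H H H (comul x ⊗ₜ z))) (h : H) :
    P (comul h) = Q (comul h) := by
  have hP' : P = F ∘ₗ comul.lTensor H := by
    ext x y; simp [hP]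
  have hQ' : Q = F ∘ₗ (TensorProduct.assoc k H H H).toLinearMap ∘ₗ comul.rTensor H := by
    ext x y; simp [hQ]
  rw [hP', hQ']
  simp [coassoc_apply]

open Coalgebra HopfAlgebra in
/-- A realization turns the action into the adjoint action:
`a ◁ g = Σ f(S g₁) · (a · f(g₂))`. -/
lemma IsRealization.act_eq {k H A : Type*} [CommRing k] [Ring H] [Ring A]
    [HopfAlgebra k H] [Algebra k A] {ma : RightModuleAlgebra k H A} {f : H →ₐ[k] A}
    (hf : IsRealization ma f) (a : A) (g : H) :
    ma.act a g = LinearMap.mul' k A (TensorProduct.map (f.toLinearMap ∘ₗ antipode k)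
      (LinearMap.mulLeft k a ∘ₗ f.toLinearMap) (comul g)) := by
  have key := apply_comul_eq_of_coassoc
    (LinearMap.mul' k A ∘ₗ TensorProduct.map (f.toLinearMap ∘ₗ antipode k)
      (LinearMap.mul' k A ∘ₗ TensorProduct.map f.toLinearMap (ma.act a)))
    (LinearMap.mul' k A ∘ₗ TensorProduct.map (f.toLinearMap ∘ₗ antipode k)
      (LinearMap.mulLeft k a ∘ₗ f.toLinearMap))
    (ma.act a ∘ₗ (TensorProduct.lid k H).toLinearMap ∘ₗ counit.rTensor H)
    (fun x y => by simp [hf a y])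
    (fun x z => by
      have hx : f (LinearMap.mul' k H ((antipode k).rTensor H (comul (R := k) x))) * ma.act a z
          = counit (R := k) x • ma.act a z := by
        rw [mul_antipode_rTensor_comul_apply, AlgHom.commutes, Algebra.smul_def]
      simp only [LinearMap.comp_apply, LinearMap.rTensor_tmul, LinearEquiv.coe_coe,
        TensorProduct.lid_tmul, map_smul]
      rw [← hx]
      generalize comul (R := k) x = t
      induction t with
      | zero => simp
      | tmul u v => simp [mul_assoc]
      | add s t hs ht => simp only [map_add, add_mul, TensorProduct.add_tmul, hs, ht]) g
  simp only [LinearMap.comp_apply] at key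
  rw [key]
  simp

/-- The `k`-linear map `h ↦ (S h*)*`. -/
noncomputable def starAntipode (k H : Type*) [CommRing k] [StarRing k] [Ring H]
    [HopfAlgebra k H] [StarRing H] [StarModule k H] : H →ₗ[k] H where
  toFun h := star (HopfAlgebra.antipode k (star h))
  map_add' x y := by simp
  map_smul' r x := by simp [star_smul]

lemma starAntipode_apply {k H : Type*} [CommRing k] [StarRing k] [Ring H]
    [HopfAlgebra k H] [StarRing H] [StarModule k H] (h : H) :
    starAntipode k H h = star (HopfAlgebra.antipode k (star h)) := rfl

@[simp]
lemma starTensor_tmul {k H : Type*} [CommRing k] [StarRing k] [Ring H]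
    [Algebra k H] [StarRing H] [StarModule k H] (x y : H) :
    starTensor k H (x ⊗ₜ y) = star x ⊗ₜ star y := rfl

lemma star_algebraMap {k H : Type*} [CommRing k] [StarRing k] [Ring H]
    [Algebra k H] [StarRing H] [StarModule k H] (r : k) :
    star (algebraMap k H r) = algebraMap k H (star r) := by
  simp [Algebra.algebraMap_eq_smul_one, star_smul]

open Coalgebra HopfAlgebra in
/-- `Σ (S h₂*)* · h₁ = ε(h)`. -/
lemma mul_starAntipode_comul {k H : Type*} [CommRing k] [StarRing k] [Ring H]
    [HopfAlgebra k H] [StarRing H] [StarModule k H]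
    (hΔ : ∀ g : H, comul (R := k) (star g) = starTensor k H (comul (R := k) g))
    (hε : ∀ g : H, counit (R := k) (star g) = star (counit (R := k) g)) (h : H) :
    LinearMap.mul' k H (TensorProduct.map (starAntipode k H) LinearMap.id
      (TensorProduct.comm k H H (comul h))) = algebraMap k H (counit h) := by
  obtain ⟨g, rfl⟩ := star_involutive.surjective h
  rw [hΔ, hε, ← star_algebraMap, ← mul_antipode_lTensor_comul_apply]
  generalize comul (R := k) g = t
  induction t with
  | zero => simp
  | tmul u v => simp [starAntipode_apply]
  | add s t hs ht => simp only [map_add, star_add, hs, ht]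

open Coalgebra HopfAlgebra in
/-- `Σ f((S h₂*)*) ◁ h₁ = f(S h)`. -/
lemma IsRealization.act_starAntipode_comul {k H A : Type*} [CommRing k] [StarRing k] [Ring H]
    [Ring A] [HopfAlgebra k H] [Algebra k A] [StarRing H] [StarModule k H]
    {ma : RightModuleAlgebra k H A} {f : H →ₐ[k] A} (hf : IsRealization ma f)
    (hΔ : ∀ g : H, comul (R := k) (star g) = starTensor k H (comul (R := k) g))
    (hε : ∀ g : H, counit (R := k) (star g) = star (counit (R := k) g)) (h : H) :
    TensorProduct.lift (ma.act ∘ₗ f.toLinearMap ∘ₗ starAntipode k H).flip (comul h)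
      = f (antipode k h) := by
  rw [← apply_comul_eq_of_coassoc
    (LinearMap.mul' k A ∘ₗ TensorProduct.map (f.toLinearMap ∘ₗ antipode k)
      (f.toLinearMap ∘ₗ LinearMap.mul' k H ∘ₗ
        TensorProduct.map (starAntipode k H) LinearMap.id ∘ₗ
          (TensorProduct.comm k H H).toLinearMap))
    (f.toLinearMap ∘ₗ antipode k ∘ₗ (TensorProduct.rid k H).toLinearMap ∘ₗ counit.lTensor H)
    _
    (fun x y => by
      simp [mul_starAntipode_comul hΔ hε y, Algebra.algebraMap_eq_smul_one])
    (fun x z => by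
      simp only [TensorProduct.lift.tmul, LinearMap.flip_apply, LinearMap.comp_apply,
        hf.act_eq _ x]
      generalize comul (R := k) x = t
      induction t with
      | zero => simp
      | tmul u v => simp
      | add s t hs ht => simp only [map_add, TensorProduct.add_tmul, hs, ht])]
  simp

open Coalgebra HopfAlgebra in
/-- `ζ(h) = Σ j(f((S h₂*)*)) · ι(h₁)`. -/
lemma zeta_eq_mul_starAntipode {k H A B : Type*} [CommRing k] [StarRing k] [Ring H] [Ring A]
    [Ring B] [HopfAlgebra k H] [Algebra k A] [Algebra k B] [StarRing H] [StarModule k H]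
    {ma : RightModuleAlgebra k H A} (cp : CrossProductModel k H A B ma)
    {f : H →ₐ[k] A} (hf : IsRealization ma f)
    (hΔ : ∀ g : H, comul (R := k) (star g) = starTensor k H (comul (R := k) g))
    (hε : ∀ g : H, counit (R := k) (star g) = star (counit (R := k) g)) (h : H) :
    zeta cp f h = LinearMap.mul' k B (TensorProduct.map
      (cp.j.toLinearMap ∘ₗ f.toLinearMap ∘ₗ starAntipode k H) cp.ι.toLinearMap
      (TensorProduct.comm k H H (comul h))) :=
  apply_comul_eq_of_coassoc
    (LinearMap.mul' k B ∘ₗ TensorProduct.map cp.ι.toLinearMap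
      (cp.j.toLinearMap ∘ₗ
        TensorProduct.lift (ma.act ∘ₗ f.toLinearMap ∘ₗ starAntipode k H).flip))
    (LinearMap.mul' k B ∘ₗ TensorProduct.map cp.ι.toLinearMap
      (cp.j.toLinearMap ∘ₗ f.toLinearMap ∘ₗ antipode k))
    (LinearMap.mul' k B ∘ₗ TensorProduct.map
      (cp.j.toLinearMap ∘ₗ f.toLinearMap ∘ₗ starAntipode k H) cp.ι.toLinearMap ∘ₗ
      (TensorProduct.comm k H H).toLinearMap)
    (fun x y => by simp [hf.act_starAntipode_comul hΔ hε y])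
    (fun x z => by
      simp only [LinearMap.comp_apply, LinearEquiv.coe_coe, TensorProduct.comm_tmul,
        TensorProduct.map_tmul, LinearMap.mul'_apply, AlgHom.toLinearMap_apply, cp.straighten]
      generalize comul (R := k) x = t
      induction t with
      | zero => simp
      | tmul u v => simp
      | add s t hs ht => simp only [map_add, TensorProduct.add_tmul, hs, ht]) h

/-- if `H`, `A`, `B` are `*`-algebras (over the field `k` with involution),
`Δ` and `ε` are `*`-homomorphisms on `H`, `(a ◁ g)* = a* ◁ (S g)*`, `j` and `ι` are
`*`-homomorphisms and the realization `f` is a `*`-algebra homomorphism, then `ζ` is a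
`*`-algebra homomorphism: `ζ(g*) = (ζ(g))*` for all `g ∈ H`. -/
theorem zeta_star {k H A B : Type*} [Field k] [StarRing k] [Ring H] [Ring A] [Ring B]
    [HopfAlgebra k H] [Algebra k A] [Algebra k B]
    [StarRing H] [StarRing A] [StarRing B]
    [StarModule k H] [StarModule k A] [StarModule k B]
    (ma : RightModuleAlgebra k H A) (cp : CrossProductModel k H A B ma)
    (f : H →ₐ[k] A) (hf : IsRealization ma f)
    (hΔ : ∀ g : H, Coalgebra.comul (R := k) (star g) = starTensor k H (Coalgebra.comul (R := k) g))
    (hε : ∀ g : H, Coalgebra.counit (R := k) (star g) = star (Coalgebra.counit (R := k) g))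
    (hact : ∀ (a : A) (g : H),
      star (ma.act a g) = ma.act (star a) (star (HopfAlgebra.antipode (R := k) g)))
    (hj : ∀ a : A, cp.j (star a) = star (cp.j a))
    (hι : ∀ g : H, cp.ι (star g) = star (cp.ι g))
    (hfstar : ∀ g : H, f (star g) = star (f g)) :
    ∀ g : H, zeta cp f (star g) = star (zeta cp f g) := by
  intro g
  rw [zeta_eq_mul_starAntipode cp hf hΔ hε, hΔ, zeta]
  simp only [LinearMap.comp_apply]
  generalize Coalgebra.comul (R := k) g = t
  induction t with
  | zero => simp
  | tmul u v => simp [starAntipode_apply, hj, hι, hfstar]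
  | add s t hs ht => simp only [map_add, star_add, hs, ht]
end

section
/- Every element of B is a finite sum Σᵢ ζ⁺(gᵢ⁺) ζ⁻(gᵢ⁻) j(aᵢ) with gᵢ⁺ ∈ H⁺, gᵢ⁻ ∈ H⁻, aᵢ ∈ A, and also a finite sum Σᵢ ζ⁻(hᵢ⁻) ζ⁺(hᵢ⁺) j(bᵢ); that is, B = ζ⁺(H⁺) ζ⁻(H⁻) j(A) = ζ⁻(H⁻) ζ⁺(H⁺) j(A). -/
/-!
Context: `H` is a Hopf algebra over a field `k`, `A` is a right `H`-module algebra,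
`B` is a model of the cross product `A ⋊ H`, `f : H → A` is a realization of `H` in `A`,
and `ζ : H → B` is defined by `ζ(g) = Σ ι(g₍₁₎) · j(f(S g₍₂₎))`.
-/

open TensorProduct

/-- The data of a Gauss decomposition `H = H⁺H⁻ = H⁻H⁺` into Hopf subalgebras
(presented abstractly: Hopf algebras `Hp`, `Hm` together with injective algebra maps
`ip, im` into `H` respecting the coalgebra structure, such that the products
`ip(H⁺)·im(H⁻)` and `im(H⁻)·ip(H⁺)` span `H`), together with realizations
`f⁺ : H⁺ → A`, `f⁻ : H⁻ → A` that agree on `H⁺ ∩ H⁻`, for a cross product model `B`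
of `A ⋊ H`. -/
structure GaussRealizationData (k H A B Hp Hm : Type*) [CommRing k] [Ring H] [Ring A]
    [Ring B] [HopfAlgebra k H] [Algebra k A] [Algebra k B] [Ring Hp] [Ring Hm]
    [HopfAlgebra k Hp] [HopfAlgebra k Hm] (ma : RightModuleAlgebra k H A) where
  cp : CrossProductModel k H A B ma
  ip : Hp →ₐ[k] H
  im : Hm →ₐ[k] H
  ip_inj : Function.Injective ip
  im_inj : Function.Injective im
  ip_comul : ∀ g : Hp, Coalgebra.comul (R := k) (ip g) =
    TensorProduct.map ip.toLinearMap ip.toLinearMap (Coalgebra.comul (R := k) g)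
  ip_counit : ∀ g : Hp, Coalgebra.counit (R := k) (ip g) = Coalgebra.counit (R := k) g
  im_comul : ∀ g : Hm, Coalgebra.comul (R := k) (im g) =
    TensorProduct.map im.toLinearMap im.toLinearMap (Coalgebra.comul (R := k) g)
  im_counit : ∀ g : Hm, Coalgebra.counit (R := k) (im g) = Coalgebra.counit (R := k) g
  gauss_pm : ∀ h : H,
    h ∈ Submodule.span k {x : H | ∃ (gp : Hp) (gm : Hm), x = ip gp * im gm}
  gauss_mp : ∀ h : H,
    h ∈ Submodule.span k {x : H | ∃ (gm : Hm) (gp : Hp), x = im gm * ip gp}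
  fp : Hp →ₐ[k] A
  fm : Hm →ₐ[k] A
  fp_real : ∀ (a : A) (g : Hp), a * fp g =
    LinearMap.mul' k A (TensorProduct.map fp.toLinearMap ((ma.act a) ∘ₗ ip.toLinearMap)
      (Coalgebra.comul (R := k) g))
  fm_real : ∀ (a : A) (g : Hm), a * fm g =
    LinearMap.mul' k A (TensorProduct.map fm.toLinearMap ((ma.act a) ∘ₗ im.toLinearMap)
      (Coalgebra.comul (R := k) g))
  agree : ∀ (gp : Hp) (gm : Hm), ip gp = im gm → fp gp = fm gm

variable {k H A B Hp Hm : Type*} [CommRing k] [Ring H] [Ring A] [Ring B]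
  [HopfAlgebra k H] [Algebra k A] [Algebra k B] [Ring Hp] [Ring Hm]
  [HopfAlgebra k Hp] [HopfAlgebra k Hm] {ma : RightModuleAlgebra k H A}

/-- The map `ζ⁺ : H⁺ → B`, `ζ⁺(g) = Σ ι(g₍₁₎) · j(f⁺(S g₍₂₎))` for `g ∈ H⁺`. -/
noncomputable def zetaP (d : GaussRealizationData k H A B Hp Hm ma) : Hp →ₗ[k] B :=
  LinearMap.mul' k B ∘ₗ
    TensorProduct.map (d.cp.ι.toLinearMap ∘ₗ d.ip.toLinearMap)
      (d.cp.j.toLinearMap ∘ₗ d.fp.toLinearMap ∘ₗ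
        (HopfAlgebra.antipode (R := k) (A := Hp))) ∘ₗ
    Coalgebra.comul (R := k)

/-- The map `ζ⁻ : H⁻ → B`, `ζ⁻(g) = Σ ι(g₍₁₎) · j(f⁻(S g₍₂₎))` for `g ∈ H⁻`. -/
noncomputable def zetaM (d : GaussRealizationData k H A B Hp Hm ma) : Hm →ₗ[k] B :=
  LinearMap.mul' k B ∘ₗ
    TensorProduct.map (d.cp.ι.toLinearMap ∘ₗ d.im.toLinearMap)
      (d.cp.j.toLinearMap ∘ₗ d.fm.toLinearMap ∘ₗ
        (HopfAlgebra.antipode (R := k) (A := Hm))) ∘ₗ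
    Coalgebra.comul (R := k)

namespace LinearMap

open WithConv

section Coalgebra

variable {R C B : Type*} [CommRing R] [Ring B] [Algebra R B]
  [AddCommGroup C] [Module R C] [Coalgebra R C]

variable (R C) in
/-- The element `c ↦ b ε(c)` of the convolution algebra. -/
noncomputable def convConst (b : B) :
    WithConv (C →ₗ[R] B) :=
  toConv (mulLeft R b ∘ₗ (1 : WithConv (C →ₗ[R] B)).ofConv)

lemma convConst_mul_apply (b : B) (u : WithConv (C →ₗ[R] B)) (c : C) :
    (convConst R C b * u) c = b * u c := by
  conv_rhs => rw [← one_mul u]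
  simp only [(Coalgebra.Repr.arbitrary R c).convMul_apply, Finset.mul_sum, ← mul_assoc]
  rfl

lemma mul_convConst_apply (b : B) (u : WithConv (C →ₗ[R] B)) (c : C) :
    (u * convConst R C b) c = u c * b := by
  conv_rhs => rw [← mul_one u]
  simp only [(Coalgebra.Repr.arbitrary R c).convMul_apply, Finset.sum_mul, mul_assoc]
  refine Finset.sum_congr rfl fun i _ ↦ congrArg _ ?_
  exact (Algebra.commutes _ b).symm

end Coalgebra

variable {R C B : Type*} [CommRing R] [Ring B] [Algebra R B] [Ring C] [HopfAlgebra R C]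

lemma convMul_comp_antipode (φ : C →ₐ[R] B) :
    toConv φ.toLinearMap * toConv (φ.toLinearMap ∘ₗ HopfAlgebra.antipode R) = 1 := by
  have h := algHom_comp_convMul_distrib φ (toConv id) (toConv (HopfAlgebra.antipode R (A := C)))
  rw [id_mul_antipode] at h
  ext c
  simpa using (LinearMap.congr_fun h c).symm

lemma comp_antipode_convMul (φ : C →ₐ[R] B) :
    toConv (φ.toLinearMap ∘ₗ HopfAlgebra.antipode R) * toConv φ.toLinearMap = 1 := by
  have h := algHom_comp_convMul_distrib φ (toConv (HopfAlgebra.antipode R (A := C))) (toConv id)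
  rw [antipode_mul_id] at h
  ext c
  simpa using (LinearMap.congr_fun h c).symm

/-- If `E` intertwines both `I` and the algebra map `φ` with left multiplication by `b`, then the
convolution of `I` with `φ ∘ S` takes values in the centralizer of `b`. -/
lemma commute_convMul_comp_antipode {I E : WithConv (C →ₗ[R] B)} {φ : C →ₐ[R] B} {b : B}
    (hI : ∀ c, b * I c = (I * E) c) (hφ : ∀ c, b * φ c = (toConv φ.toLinearMap * E) c) (c : C) :
    Commute b ((I * toConv (φ.toLinearMap ∘ₗ HopfAlgebra.antipode R)) c) := by
  set F := toConv φ.toLinearMap with hF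
  set G := toConv (φ.toLinearMap ∘ₗ HopfAlgebra.antipode R) with hG
  have hI' : convConst R C b * I = I * E := by
    ext c; exact (convConst_mul_apply b I c).trans (hI c)
  have hφ' : convConst R C b * F = F * E := by
    ext c; exact (convConst_mul_apply b F c).trans (hφ c)
  have hFG : F * G = 1 := convMul_comp_antipode φ
  have hGF : G * F = 1 := comp_antipode_convMul φ
  have hEG : E * G = G * convConst R C b := by
    calc E * G = G * F * E * G := by rw [hGF, one_mul]
      _ = G * (F * E) * G := by rw [mul_assoc G F E]
      _ = G * convConst R C b * (F * G) := by rw [← hφ']; simp only [mul_assoc]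
      _ = G * convConst R C b := by rw [hFG, mul_one]
  have key : convConst R C b * (I * G) = I * G * convConst R C b := by
    rw [← mul_assoc, hI', mul_assoc, hEG, mul_assoc]
  rw [Commute, SemiconjBy, ← convConst_mul_apply, key, mul_convConst_apply]

lemma convMul_comp_antipode_convMul (I : WithConv (C →ₗ[R] B)) (φ : C →ₐ[R] B) :
    I * toConv (φ.toLinearMap ∘ₗ HopfAlgebra.antipode R) * toConv φ.toLinearMap = I := by
  rw [mul_assoc, comp_antipode_convMul, mul_one]

end LinearMap

namespace GaussRealizationData

open WithConv

variable (d : GaussRealizationData k H A B Hp Hm ma)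

lemma commute_j_zetaP (a : A) (g : Hp) : Commute (d.cp.j a) (zetaP d g) := by
  refine LinearMap.commute_convMul_comp_antipode
    (I := toConv (d.cp.ι.toLinearMap ∘ₗ d.ip.toLinearMap)) (φ := d.cp.j.comp d.fp)
    (E := toConv (d.cp.j.toLinearMap ∘ₗ ma.act a ∘ₗ d.ip.toLinearMap)) (fun c ↦ ?_) (fun c ↦ ?_) g
  · refine (d.cp.straighten a (d.ip c)).trans ?_
    rw [d.ip_comul, LinearMap.convMul_apply, ← LinearMap.comp_apply (TensorProduct.map _ _),
      ← TensorProduct.map_comp]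
    rfl
  · rw [AlgHom.comp_apply, ← map_mul, d.fp_real]
    exact LinearMap.congr_fun (LinearMap.algHom_comp_convMul_distrib d.cp.j
      (toConv d.fp.toLinearMap) (toConv (ma.act a ∘ₗ d.ip.toLinearMap))) c

lemma ι_ip_eq_sum (g : Hp) {ι' : Type*} (r : Coalgebra.Repr k g ι') :
    d.cp.ι (d.ip g) = ∑ i ∈ r.index, zetaP d (r.left i) * d.cp.j (d.fp (r.right i)) := by
  have h := LinearMap.convMul_comp_antipode_convMul
    (toConv (d.cp.ι.toLinearMap ∘ₗ d.ip.toLinearMap)) (d.cp.j.comp d.fp)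
  exact (congrArg (fun u ↦ u.ofConv g) h).symm.trans (r.convMul_apply _ _)

/-- Interchanging the roles of `H⁺` and `H⁻`. -/
def swap : GaussRealizationData k H A B Hm Hp ma where
  cp := d.cp
  ip := d.im
  im := d.ip
  ip_inj := d.im_inj
  im_inj := d.ip_inj
  ip_comul := d.im_comul
  ip_counit := d.im_counit
  im_comul := d.ip_comul
  im_counit := d.ip_counit
  gauss_pm := d.gauss_mp
  gauss_mp := d.gauss_pm
  fp := d.fm
  fm := d.fp
  fp_real := d.fm_real
  fm_real := d.fp_real
  agree gp gm h := (d.agree gm gp h.symm).symm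

lemma ι_im_eq_sum (g : Hm) {ι' : Type*} (r : Coalgebra.Repr k g ι') :
    d.cp.ι (d.im g) = ∑ i ∈ r.index, zetaM d (r.left i) * d.cp.j (d.fm (r.right i)) :=
  d.swap.ι_ip_eq_sum g r

lemma commute_j_zetaM (a : A) (g : Hm) : Commute (d.cp.j a) (zetaM d g) :=
  d.swap.commute_j_zetaP a g

lemma mem_span_zetaP_mul_zetaM_mul_j (b : B) :
    b ∈ Submodule.span k
      {x : B | ∃ (gp : Hp) (gm : Hm) (a : A), x = zetaP d gp * zetaM d gm * d.cp.j a} := by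
  obtain ⟨t, rfl⟩ := d.cp.mul_bij.surjective b
  induction t using TensorProduct.induction_on with
  | zero => simp
  | add x y hx hy => rw [map_add]; exact add_mem hx hy
  | tmul h a =>
    change d.cp.ι h * d.cp.j a ∈ _
    induction d.gauss_pm h using Submodule.span_induction with
    | zero => simp
    | add x y _ _ hx hy => rw [map_add, add_mul]; exact add_mem hx hy
    | smul c x _ hx => rw [map_smul, smul_mul_assoc]; exact Submodule.smul_mem _ c hx
    | mem x hx =>
      obtain ⟨gp, gm, rfl⟩ := hx
      let r := Coalgebra.Repr.arbitrary k gp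
      let s := Coalgebra.Repr.arbitrary k gm
      rw [map_mul, d.ι_ip_eq_sum gp r, d.ι_im_eq_sum gm s, Finset.sum_mul_sum, Finset.sum_mul]
      refine sum_mem fun i _ ↦ ?_
      rw [Finset.sum_mul]
      refine sum_mem fun l _ ↦ Submodule.subset_span
        ⟨r.left i, s.left l, d.fp (r.right i) * (d.fm (s.right l) * a), ?_⟩
      rw [mul_assoc (zetaP d _), ← mul_assoc (d.cp.j _) (zetaM d _), (d.commute_j_zetaM _ _).eq]
      simp only [mul_assoc, ← map_mul]

end GaussRealizationData

/-- `B = ζ⁺(H⁺) ζ⁻(H⁻) j(A) = ζ⁻(H⁻) ζ⁺(H⁺) j(A)`: every element of `B`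
is a finite sum `Σᵢ ζ⁺(gᵢ⁺) ζ⁻(gᵢ⁻) j(aᵢ)` and also a finite sum
`Σᵢ ζ⁻(hᵢ⁻) ζ⁺(hᵢ⁺) j(bᵢ)`. -/
theorem decomposition_pm_mp {k H A B Hp Hm : Type*} [Field k] [Ring H]
    [Ring A] [Ring B] [HopfAlgebra k H] [Algebra k A] [Algebra k B] [Ring Hp] [Ring Hm]
    [HopfAlgebra k Hp] [HopfAlgebra k Hm] (ma : RightModuleAlgebra k H A)
    (d : GaussRealizationData k H A B Hp Hm ma) :
    ∀ b : B,
      b ∈ Submodule.span k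
          {x : B | ∃ (gp : Hp) (gm : Hm) (a : A), x = zetaP d gp * zetaM d gm * d.cp.j a} ∧
      b ∈ Submodule.span k
          {x : B | ∃ (gm : Hm) (gp : Hp) (a : A), x = zetaM d gm * zetaP d gp * d.cp.j a} := by
  exact fun b ↦ ⟨d.mem_span_zetaP_mul_zetaM_mul_j b, d.swap.mem_span_zetaP_mul_zetaM_mul_j b⟩
end

section
/- The unbraiding map χ⁺ : A₂ → C defined by χ⁺(a₂) = Σ j₁(f₁(R⁽¹⁾)) · j₂(a₂ ◁ R⁽²⁾) is a homomorphism of unital k-algebras. -/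
/-!
Context: `(H, R)` is a quasitriangular Hopf algebra over a field `k`, `H⁺, H⁻` are Hopf
subalgebras with `R ∈ H⁺ ⊗ H⁻`, `A₁` is a right `H⁺`-module algebra, `A₂` a right
`H⁻`-module algebra, `C` is a model of the braided tensor product `A₁ ⊗̲⁺ A₂`,
`f₁ : H⁺ → A₁` is a realization, and `χ⁺ : A₂ → C` is defined by
`χ⁺(a₂) = Σ j₁(f₁(R⁽¹⁾)) · j₂(a₂ ◁ R⁽²⁾)`.
-/

open TensorProduct

/-- `Rb ∈ H ⊗ H` is a quasitriangular structure on the Hopf algebra `H`: it is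
invertible, `(Δ ⊗ id)(R) = R₁₃R₂₃`, `(id ⊗ Δ)(R) = R₁₃R₁₂`, and
`Δᵒᵖ(h)·R = R·Δ(h)` for all `h ∈ H`. -/
structure IsQuasitriangular (k H : Type*) [CommRing k] [Ring H] [HopfAlgebra k H]
    (Rb : H ⊗[k] H) : Prop where
  isUnit : IsUnit Rb
  comul_id : TensorProduct.map (Coalgebra.comul (R := k)) (LinearMap.id (M := H)) Rb =
    TensorProduct.map ((TensorProduct.mk k H H).flip 1) LinearMap.id Rb *
      TensorProduct.map (TensorProduct.mk k H H 1) LinearMap.id Rb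
  id_comul : TensorProduct.map (LinearMap.id (M := H)) (Coalgebra.comul (R := k)) Rb =
    TensorProduct.map LinearMap.id (TensorProduct.mk k H H 1) Rb *
      TensorProduct.map LinearMap.id ((TensorProduct.mk k H H).flip 1) Rb
  intertwine : ∀ h : H,
    (TensorProduct.comm k H H) (Coalgebra.comul (R := k) h) * Rb =
      Rb * Coalgebra.comul (R := k) h

/-- Hopf subalgebras `H⁺, H⁻` of `H` (presented abstractly as Hopf algebras `Hp, Hm`
with injective algebra maps into `H` respecting the coalgebra structure), together
with an element `R ∈ H⁺ ⊗ H⁻` whose image in `H ⊗ H` is a quasitriangular structure. -/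
structure QTSubData (k H Hp Hm : Type*) [CommRing k] [Ring H] [Ring Hp] [Ring Hm]
    [HopfAlgebra k H] [HopfAlgebra k Hp] [HopfAlgebra k Hm] where
  ip : Hp →ₐ[k] H
  im : Hm →ₐ[k] H
  ip_inj : Function.Injective ip
  im_inj : Function.Injective im
  ip_comul : ∀ g : Hp, Coalgebra.comul (R := k) (ip g) =
    TensorProduct.map ip.toLinearMap ip.toLinearMap (Coalgebra.comul (R := k) g)
  ip_counit : ∀ g : Hp, Coalgebra.counit (R := k) (ip g) = Coalgebra.counit (R := k) g
  im_comul : ∀ g : Hm, Coalgebra.comul (R := k) (im g) =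
    TensorProduct.map im.toLinearMap im.toLinearMap (Coalgebra.comul (R := k) g)
  im_counit : ∀ g : Hm, Coalgebra.counit (R := k) (im g) = Coalgebra.counit (R := k) g
  R : Hp ⊗[k] Hm
  qt : IsQuasitriangular k H (TensorProduct.map ip.toLinearMap im.toLinearMap R)

/-- A model of the braided tensor product `A₁ ⊗̲⁺ A₂`: a unital associative
`k`-algebra `C` with algebra maps `j₁ : A₁ → C`, `j₂ : A₂ → C` such that
`a₁ ⊗ a₂ ↦ j₁(a₁) j₂(a₂)` is a linear isomorphism `A₁ ⊗ₖ A₂ ≃ C` and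
`j₂(a₂) j₁(a₁) = Σ j₁(a₁ ◁ R⁽¹⁾) j₂(a₂ ◁ R⁽²⁾)`. -/
structure BraidedTPModel (k H Hp Hm A₁ A₂ C : Type*) [CommRing k] [Ring H] [Ring Hp]
    [Ring Hm] [Ring A₁] [Ring A₂] [Ring C] [HopfAlgebra k H] [HopfAlgebra k Hp]
    [HopfAlgebra k Hm] [Algebra k A₁] [Algebra k A₂] [Algebra k C]
    (q : QTSubData k H Hp Hm)
    (ma1 : RightModuleAlgebra k Hp A₁) (ma2 : RightModuleAlgebra k Hm A₂) where
  j₁ : A₁ →ₐ[k] C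
  j₂ : A₂ →ₐ[k] C
  mul_bij : Function.Bijective
    ((LinearMap.mul' k C) ∘ₗ (TensorProduct.map j₁.toLinearMap j₂.toLinearMap))
  braid : ∀ (a₁ : A₁) (a₂ : A₂),
    j₂ a₂ * j₁ a₁ =
      LinearMap.mul' k C
        (TensorProduct.map (j₁.toLinearMap ∘ₗ ma1.act a₁)
          (j₂.toLinearMap ∘ₗ ma2.act a₂) q.R)

variable {k H Hp Hm A₁ A₂ C : Type*} [CommRing k] [Ring H] [Ring Hp]
  [Ring Hm] [Ring A₁] [Ring A₂] [Ring C] [HopfAlgebra k H] [HopfAlgebra k Hp]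
  [HopfAlgebra k Hm] [Algebra k A₁] [Algebra k A₂] [Algebra k C]
  {q : QTSubData k H Hp Hm}
  {ma1 : RightModuleAlgebra k Hp A₁} {ma2 : RightModuleAlgebra k Hm A₂}

/-- The unbraiding map `χ⁺ : A₂ → C`, `χ⁺(a₂) = Σ j₁(f₁(R⁽¹⁾)) · j₂(a₂ ◁ R⁽²⁾)`
(a `k`-linear map). -/
noncomputable def chiPlus (btp : BraidedTPModel k H Hp Hm A₁ A₂ C q ma1 ma2)
    (f₁ : Hp →ₐ[k] A₁) : A₂ →ₗ[k] C where
  toFun a₂ :=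
    LinearMap.mul' k C
      (TensorProduct.map (btp.j₁.toLinearMap ∘ₗ f₁.toLinearMap)
        (btp.j₂.toLinearMap ∘ₗ ma2.act a₂) q.R)
  map_add' a b := by
    simp only [map_add, LinearMap.comp_add, TensorProduct.map_add_right, LinearMap.add_apply]
  map_smul' c a := by
    simp only [map_smul, LinearMap.comp_smul, TensorProduct.map_smul_right,
      LinearMap.smul_apply, RingHom.id_apply]

namespace QTSubData

section

variable {k H Hp Hm : Type*} [Field k] [Ring H] [Ring Hp] [Ring Hm] [HopfAlgebra k H]
  [HopfAlgebra k Hp] [HopfAlgebra k Hm] (q : QTSubData k H Hp Hm)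

/-- `(Δ ⊗ id)(R) = R₁₃R₂₃` holds in `H⁺ ⊗ H⁺ ⊗ H⁻`. -/
theorem comul_id :
    TensorProduct.map (Coalgebra.comul (R := k)) (LinearMap.id (M := Hm)) q.R =
      TensorProduct.map ((TensorProduct.mk k Hp Hp).flip 1) LinearMap.id q.R *
        TensorProduct.map (TensorProduct.mk k Hp Hp 1) LinearMap.id q.R := by
  let Φ := Algebra.TensorProduct.map (Algebra.TensorProduct.map q.ip q.ip) q.im
  have hΦ : Function.Injective Φ :=
    TensorProduct.map_injective_of_flat_flat
      (TensorProduct.map q.ip.toLinearMap q.ip.toLinearMap) q.im.toLinearMap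
      (TensorProduct.map_injective_of_flat_flat q.ip.toLinearMap q.ip.toLinearMap
        q.ip_inj q.ip_inj) q.im_inj
  have transport (u : Hp →ₗ[k] Hp ⊗[k] Hp) (v : H →ₗ[k] H ⊗[k] H)
      (h : ∀ g, v (q.ip g) = TensorProduct.map q.ip.toLinearMap q.ip.toLinearMap (u g)) :
      Φ (TensorProduct.map u LinearMap.id q.R) =
        TensorProduct.map v LinearMap.id
          (TensorProduct.map q.ip.toLinearMap q.im.toLinearMap q.R) := by
    have hcomp : Φ.toLinearMap ∘ₗ TensorProduct.map u LinearMap.id =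
        TensorProduct.map v LinearMap.id ∘ₗ
          TensorProduct.map q.ip.toLinearMap q.im.toLinearMap :=
      TensorProduct.ext' fun g g' => by
        simp only [LinearMap.comp_apply, TensorProduct.map_tmul, AlgHom.toLinearMap_apply, h]
        rfl
    exact LinearMap.congr_fun hcomp q.R
  apply hΦ
  rw [map_mul, transport _ _ q.ip_comul, transport _ ((TensorProduct.mk k H H).flip 1),
    transport _ (TensorProduct.mk k H H 1), q.qt.comul_id]
  all_goals intro g; simp

/-- `(id ⊗ Δ)(R) = R₁₃R₁₂` holds in `H⁺ ⊗ H⁻ ⊗ H⁻`. -/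
theorem id_comul :
    TensorProduct.map (LinearMap.id (M := Hp)) (Coalgebra.comul (R := k)) q.R =
      TensorProduct.map LinearMap.id (TensorProduct.mk k Hm Hm 1) q.R *
        TensorProduct.map LinearMap.id ((TensorProduct.mk k Hm Hm).flip 1) q.R := by
  let Φ := Algebra.TensorProduct.map q.ip (Algebra.TensorProduct.map q.im q.im)
  have hΦ : Function.Injective Φ :=
    TensorProduct.map_injective_of_flat_flat q.ip.toLinearMap
      (TensorProduct.map q.im.toLinearMap q.im.toLinearMap) q.ip_inj
      (TensorProduct.map_injective_of_flat_flat q.im.toLinearMap q.im.toLinearMap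
        q.im_inj q.im_inj)
  have transport (u : Hm →ₗ[k] Hm ⊗[k] Hm) (v : H →ₗ[k] H ⊗[k] H)
      (h : ∀ g, v (q.im g) = TensorProduct.map q.im.toLinearMap q.im.toLinearMap (u g)) :
      Φ (TensorProduct.map LinearMap.id u q.R) =
        TensorProduct.map LinearMap.id v
          (TensorProduct.map q.ip.toLinearMap q.im.toLinearMap q.R) := by
    have hcomp : Φ.toLinearMap ∘ₗ TensorProduct.map LinearMap.id u =
        TensorProduct.map LinearMap.id v ∘ₗ
          TensorProduct.map q.ip.toLinearMap q.im.toLinearMap :=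
      TensorProduct.ext' fun g g' => by
        simp only [LinearMap.comp_apply, TensorProduct.map_tmul, AlgHom.toLinearMap_apply, h]
        rfl
    exact LinearMap.congr_fun hcomp q.R
  apply hΦ
  rw [map_mul, transport _ _ q.im_comul, transport _ (TensorProduct.mk k H H 1),
    transport _ ((TensorProduct.mk k H H).flip 1), q.qt.id_comul]
  all_goals intro g; simp

end

end QTSubData

/-- `(id ⊗ ε)(R) = 1` for a quasitriangular structure `R`. -/
theorem IsQuasitriangular.id_counit {k H : Type*} [CommRing k] [Ring H] [HopfAlgebra k H]
    {Rb : H ⊗[k] H} (h : IsQuasitriangular k H Rb) :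
    Algebra.TensorProduct.rid k k H
      (Algebra.TensorProduct.map (AlgHom.id k H) (Bialgebra.counitAlgHom k H) Rb) = 1 := by
  set ρ : H ⊗[k] H →ₐ[k] H := (Algebra.TensorProduct.rid k k H).toAlgHom.comp
    (Algebra.TensorProduct.map (AlgHom.id k H) (Bialgebra.counitAlgHom k H))
  change ρ Rb = 1
  let ψ : H ⊗[k] (H ⊗[k] H) →ₐ[k] H ⊗[k] H := Algebra.TensorProduct.map (AlgHom.id k H)
    ((Algebra.TensorProduct.lid k H).toAlgHom.comp
      (Algebra.TensorProduct.map (Bialgebra.counitAlgHom k H) (AlgHom.id k H)))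
  have h₁ : ψ.toLinearMap ∘ₗ TensorProduct.map LinearMap.id (Coalgebra.comul (R := k)) =
      LinearMap.id := TensorProduct.ext' fun a b => by
    have := congr(TensorProduct.lid k H $(Coalgebra.rTensor_counit_comul (R := k) b))
    rw [TensorProduct.lid_tmul, one_smul] at this
    change a ⊗ₜ[k] _ = a ⊗ₜ[k] b
    exact congr(a ⊗ₜ[k] $this)
  have h₂ : ψ.toLinearMap ∘ₗ TensorProduct.map LinearMap.id (TensorProduct.mk k H H 1) =
      LinearMap.id := TensorProduct.ext' fun a b => by simp [ψ]
  have h₃ : ψ.toLinearMap ∘ₗ TensorProduct.map LinearMap.id ((TensorProduct.mk k H H).flip 1) =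
      (TensorProduct.mk k H H).flip 1 ∘ₗ ρ.toLinearMap := TensorProduct.ext' fun a b => by
    simp [ψ, ρ, TensorProduct.tmul_smul, TensorProduct.smul_tmul']
  have key : Rb = Rb * (ρ Rb ⊗ₜ[k] 1) := by
    have := congr(ψ $(h.id_comul))
    rw [map_mul] at this
    exact (LinearMap.congr_fun h₁ Rb).symm.trans (this.trans
      (congr($(LinearMap.congr_fun h₂ Rb) * $(LinearMap.congr_fun h₃ Rb))))
  have hone : ρ Rb ⊗ₜ[k] (1 : H) = 1 := h.isUnit.mul_eq_left.mp key.symm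
  simpa [ρ] using congr(ρ $hone)

/-- `(id ⊗ ε)(R) = 1` in `H⁺`. -/
theorem QTSubData.id_counit {k H Hp Hm : Type*} [CommRing k] [Ring H] [Ring Hp] [Ring Hm]
    [HopfAlgebra k H] [HopfAlgebra k Hp] [HopfAlgebra k Hm] (q : QTSubData k H Hp Hm) :
    TensorProduct.rid k Hp
      (TensorProduct.map LinearMap.id (Coalgebra.counit (R := k)) q.R) = 1 := by
  apply q.ip_inj
  rw [map_one, ← q.qt.id_counit]
  induction q.R with
  | zero => simp
  | tmul a b => simp [q.im_counit]
  | add x y hx hy => simp only [map_add, hx, hy]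

/-- the unbraiding map `χ⁺ : A₂ → C` is a homomorphism of unital
`k`-algebras (it is `k`-linear by construction, preserves the unit and preserves
multiplication). -/
theorem chiPlus_isAlgHom {k H Hp Hm A₁ A₂ C : Type*} [Field k] [Ring H] [Ring Hp]
    [Ring Hm] [Ring A₁] [Ring A₂] [Ring C] [HopfAlgebra k H] [HopfAlgebra k Hp]
    [HopfAlgebra k Hm] [Algebra k A₁] [Algebra k A₂] [Algebra k C]
    (q : QTSubData k H Hp Hm)
    (ma1 : RightModuleAlgebra k Hp A₁) (ma2 : RightModuleAlgebra k Hm A₂)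
    (btp : BraidedTPModel k H Hp Hm A₁ A₂ C q ma1 ma2)
    (f₁ : Hp →ₐ[k] A₁) (hf₁ : IsRealization ma1 f₁) :
    chiPlus btp f₁ 1 = 1 ∧
      ∀ x y : A₂, chiPlus btp f₁ (x * y) = chiPlus btp f₁ x * chiPlus btp f₁ y := by
  obtain ⟨s, hs⟩ := TensorProduct.exists_finset q.R
  have chi (x : A₂) : chiPlus btp f₁ x =
      ∑ i ∈ s, btp.j₁ (f₁ i.1) * btp.j₂ (ma2.act x i.2) := by
    simp [chiPlus, hs]
  refine ⟨?_, fun x y => ?_⟩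
  · have h := congr(btp.j₁ (f₁ $(q.id_counit)))
    rw [hs] at h
    rw [chi]
    simpa [ma2.one_act, Algebra.smul_def, Algebra.commutes] using h
  · -- evaluate `a ⊗ b ⊗ b' ↦ j₁(f₁(a)) j₂(x ◁ b) j₂(y ◁ b')` on `(id ⊗ Δ)(R) = R₁₃R₁₂`
    have hxy : chiPlus btp f₁ (x * y) = ∑ i ∈ s, ∑ j ∈ s,
        btp.j₁ (f₁ i.1) * btp.j₁ (f₁ j.1) *
          (btp.j₂ (ma2.act x j.2) * btp.j₂ (ma2.act y i.2)) := by
      have h := congr(LinearMap.mul' k C (TensorProduct.map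
        (btp.j₁.toLinearMap ∘ₗ f₁.toLinearMap)
        (btp.j₂.toLinearMap ∘ₗ LinearMap.mul' k A₂ ∘ₗ
          TensorProduct.map (ma2.act x) (ma2.act y)) $(q.id_comul)))
      rw [hs] at h
      rw [chi]
      simpa [ma2.mul_act, Finset.sum_mul_sum] using h
    -- evaluate `g ⊗ g' ⊗ b ↦ j₁(f₁(g) (a ◁ g')) j₂(x ◁ b)` on `(Δ ⊗ id)(R) = R₁₃R₂₃`
    have slide (c : A₁) :
        ∑ i ∈ s, btp.j₁ c * btp.j₁ (f₁ i.1) * btp.j₂ (ma2.act x i.2) =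
          ∑ i ∈ s, btp.j₁ (f₁ i.1) * (btp.j₂ (ma2.act x i.2) * btp.j₁ c) := by
      have h := congr(LinearMap.mul' k C (TensorProduct.map
        (btp.j₁.toLinearMap ∘ₗ LinearMap.mul' k A₁ ∘ₗ
          TensorProduct.map f₁.toLinearMap (ma1.act c))
        (btp.j₂.toLinearMap ∘ₗ ma2.act x) $(q.comul_id)))
      simp only [hs, map_sum, Finset.sum_mul_sum] at h
      have hf (g : Hp) : btp.j₁ c * btp.j₁ (f₁ g) = btp.j₁ (LinearMap.mul' k A₁
          (TensorProduct.map f₁.toLinearMap (ma1.act c) (Coalgebra.comul (R := k) g))) := by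
        rw [← map_mul, hf₁ c g]
      simpa [hf, btp.braid, hs, ma2.act_mul, Finset.mul_sum, mul_assoc]
        using h
    rw [hxy, chi x, chi y, Finset.sum_mul_sum, Finset.sum_comm (s := s) (t := s)
      (f := fun i j => btp.j₁ (f₁ i.1) * btp.j₂ (ma2.act x i.2) *
        (btp.j₁ (f₁ j.1) * btp.j₂ (ma2.act y j.2)))]
    refine Finset.sum_congr rfl fun i _ => ?_
    simpa [Finset.sum_mul, mul_assoc] using congr($(slide (f₁ i.1)) * btp.j₂ (ma2.act y i.2))
end

section
/- The k-linear map A₁ ⊗ₖ A₂ → C sending a₁ ⊗ a₂ to j₁(a₁) · χ⁺(a₂) is a linear isomorphism; in particular every element of C is a finite sum Σᵢ j₁(aᵢ) χ⁺(bᵢ), i.e. C = j₁(A₁) · χ⁺(A₂), exhibiting C as an ordinary (unbraided) tensor product of the commuting subalgebras j₁(A₁) and χ⁺(A₂). -/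
/-!
Context: `(H, R)` is a quasitriangular Hopf algebra over a field `k`, `H⁺, H⁻` are Hopf
subalgebras with `R ∈ H⁺ ⊗ H⁻`, `A₁` is a right `H⁺`-module algebra, `A₂` a right
`H⁻`-module algebra, `C` is a model of the braided tensor product `A₁ ⊗̲⁺ A₂`,
`f₁ : H⁺ → A₁` is a realization, and `χ⁺ : A₂ → C` is defined by
`χ⁺(a₂) = Σ j₁(f₁(R⁽¹⁾)) · j₂(a₂ ◁ R⁽²⁾)`.
-/

open TensorProduct

variable {k H Hp Hm A₁ A₂ C : Type*} [CommRing k] [Ring H] [Ring Hp]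
  [Ring Hm] [Ring A₁] [Ring A₂] [Ring C] [HopfAlgebra k H] [HopfAlgebra k Hp]
  [HopfAlgebra k Hm] [Algebra k A₁] [Algebra k A₂] [Algebra k C]
  {q : QTSubData k H Hp Hm}
  {ma1 : RightModuleAlgebra k Hp A₁} {ma2 : RightModuleAlgebra k Hm A₂}

namespace QTSubData

/-- Contracting `x₁₃ y₂₃` along `s ⊗ id` followed by multiplication gives `(s ⊗ id)(x) * y`. -/
lemma contract_mul (s : Hp →ₗ[k] Hp) (x y : Hp ⊗[k] Hm) :
    TensorProduct.map (LinearMap.mul' k Hp ∘ₗ TensorProduct.map s LinearMap.id) LinearMap.id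
      (TensorProduct.map ((TensorProduct.mk k Hp Hp).flip 1) LinearMap.id x *
        TensorProduct.map (TensorProduct.mk k Hp Hp 1) LinearMap.id y) =
      TensorProduct.map s (LinearMap.id (M := Hm)) x * y := by
  induction x with
  | zero => simp
  | add x₁ x₂ h₁ h₂ => simp only [map_add, add_mul, h₁, h₂]
  | tmul a b =>
    induction y with
    | zero => simp
    | add y₁ y₂ h₁ h₂ => simp only [map_add, mul_add, h₁, h₂]
    | tmul c d => simp

end QTSubData

section Field

variable {k H Hp Hm : Type*} [Field k] [Ring H] [Ring Hp] [Ring Hm]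
  [HopfAlgebra k H] [HopfAlgebra k Hp] [HopfAlgebra k Hm]

namespace QTSubData

/-- The inclusion `H⁺ ⊗ H⁻ → H ⊗ H` as an algebra homomorphism. -/
noncomputable def incl (q : QTSubData k H Hp Hm) : Hp ⊗[k] Hm →ₐ[k] H ⊗[k] H :=
  Algebra.TensorProduct.map q.ip q.im

lemma incl_injective (q : QTSubData k H Hp Hm) : Function.Injective q.incl :=
  TensorProduct.map_injective_of_flat_flat q.ip.toLinearMap q.im.toLinearMap q.ip_inj q.im_inj

lemma isUnit_incl_R (q : QTSubData k H Hp Hm) : IsUnit (q.incl q.R) := q.qt.isUnit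

/-- The identity `(Δ ⊗ id)(R) = R₁₃ R₂₃` already holds in `H⁺ ⊗ H⁺ ⊗ H⁻`. -/
lemma comul_id_R (q : QTSubData k H Hp Hm) :
    TensorProduct.map (Coalgebra.comul (R := k)) (LinearMap.id (M := Hm)) q.R =
      TensorProduct.map ((TensorProduct.mk k Hp Hp).flip 1) LinearMap.id q.R *
        TensorProduct.map (TensorProduct.mk k Hp Hp 1) LinearMap.id q.R := by
  have hinj : Function.Injective
      (Algebra.TensorProduct.map (Algebra.TensorProduct.map q.ip q.ip) q.im) :=
    TensorProduct.map_injective_of_flat_flat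
      (TensorProduct.map q.ip.toLinearMap q.ip.toLinearMap) q.im.toLinearMap
      (TensorProduct.map_injective_of_flat_flat _ _ q.ip_inj q.ip_inj) q.im_inj
  apply hinj
  rw [map_mul]
  have comul_eq (x : Hp ⊗[k] Hm) :
      Algebra.TensorProduct.map (Algebra.TensorProduct.map q.ip q.ip) q.im
        (TensorProduct.map (Coalgebra.comul (R := k)) LinearMap.id x) =
      TensorProduct.map (Coalgebra.comul (R := k)) LinearMap.id
        (TensorProduct.map q.ip.toLinearMap q.im.toLinearMap x) := by
    induction x with
    | zero => simp
    | add x y hx hy => simp only [map_add, hx, hy]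
    | tmul a b =>
      simp only [TensorProduct.map_tmul, AlgHom.toLinearMap_apply, q.ip_comul,
        Algebra.TensorProduct.map_tmul, LinearMap.id_apply]
      rfl
  have left_eq (x : Hp ⊗[k] Hm) :
      Algebra.TensorProduct.map (Algebra.TensorProduct.map q.ip q.ip) q.im
        (TensorProduct.map ((TensorProduct.mk k Hp Hp).flip 1) LinearMap.id x) =
      TensorProduct.map ((TensorProduct.mk k H H).flip 1) LinearMap.id
        (TensorProduct.map q.ip.toLinearMap q.im.toLinearMap x) := by
    induction x with
    | zero => simp
    | add x y hx hy => simp only [map_add, hx, hy]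
    | tmul a b => simp
  have right_eq (x : Hp ⊗[k] Hm) :
      Algebra.TensorProduct.map (Algebra.TensorProduct.map q.ip q.ip) q.im
        (TensorProduct.map (TensorProduct.mk k Hp Hp 1) LinearMap.id x) =
      TensorProduct.map (TensorProduct.mk k H H 1) LinearMap.id
        (TensorProduct.map q.ip.toLinearMap q.im.toLinearMap x) := by
    induction x with
    | zero => simp
    | add x y hx hy => simp only [map_add, hx, hy]
    | tmul a b => simp
  rw [comul_eq, left_eq, right_eq]
  exact q.qt.comul_id

/-- If `s` convolved with the identity of `H⁺` is `t`, then `(t ⊗ id)(R) = (s ⊗ id)(R) * R`. -/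
lemma map_R_eq_mul (q : QTSubData k H Hp Hm) {s t : Hp →ₗ[k] Hp}
    (hst : (LinearMap.mul' k Hp ∘ₗ TensorProduct.map s LinearMap.id) ∘ₗ
      Coalgebra.comul (R := k) = t) :
    TensorProduct.map t LinearMap.id q.R = TensorProduct.map s LinearMap.id q.R * q.R := by
  rw [← contract_mul, ← comul_id_R, ← hst, ← LinearMap.comp_apply, ← TensorProduct.map_comp,
    LinearMap.id_comp]

lemma counit_id_R (q : QTSubData k H Hp Hm) :
    TensorProduct.map (Algebra.linearMap k Hp ∘ₗ Coalgebra.counit (R := k))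
      LinearMap.id q.R = 1 := by
  have h := q.map_R_eq_mul (s := Algebra.linearMap k Hp ∘ₗ Coalgebra.counit (R := k))
    (t := LinearMap.id) (by
      rw [← LinearMap.rTensor_def, LinearMap.rTensor_comp]
      ext a
      simp [Coalgebra.rTensor_counit_comul])
  rw [TensorProduct.map_id, LinearMap.id_apply] at h
  apply q.incl_injective
  apply q.isUnit_incl_R.mul_right_cancel
  rw [← map_mul, ← h, map_one, one_mul]

/-- `R` is invertible in `H⁺ ⊗ H⁻`, with inverse `(S ⊗ id)(R)`. -/
lemma isUnit_R (q : QTSubData k H Hp Hm) : IsUnit q.R := by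
  set R' := TensorProduct.map (HopfAlgebra.antipode k (A := Hp)) (LinearMap.id (M := Hm)) q.R
  have hleft : R' * q.R = 1 := by
    rw [← q.counit_id_R]
    refine (q.map_R_eq_mul ?_).symm
    rw [← LinearMap.rTensor_def, LinearMap.comp_assoc]
    exact HopfAlgebra.mul_antipode_rTensor_comul
  have hright : q.R * R' = 1 := by
    apply q.incl_injective
    apply q.isUnit_incl_R.mul_right_cancel
    rw [← map_mul, mul_assoc, hleft, mul_one, map_one, one_mul]
  exact ⟨⟨q.R, R', hright, hleft⟩, rfl⟩

end QTSubData

end Field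

/-- The right action of `H⁺ ⊗ H⁻` on `A₁ ⊗ A₂` where `H⁺` acts on `A₁` by right multiplication
through `f₁`. -/
noncomputable def mulAct (ma2 : RightModuleAlgebra k Hm A₂) (f₁ : Hp →ₐ[k] A₁) :
    Hp ⊗[k] Hm →ₗ[k] A₁ ⊗[k] A₂ →ₗ[k] A₁ ⊗[k] A₂ :=
  TensorProduct.homTensorHomMap (RingHom.id k) A₁ A₂ A₁ A₂ ∘ₗ
    TensorProduct.map ((LinearMap.mul k A₁).flip ∘ₗ f₁.toLinearMap) ma2.act.flip

@[simp]
lemma mulAct_tmul (f₁ : Hp →ₐ[k] A₁) (g : Hp) (g' : Hm) (a : A₁) (b : A₂) :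
    mulAct ma2 f₁ (g ⊗ₜ g') (a ⊗ₜ b) = (a * f₁ g) ⊗ₜ ma2.act b g' := by
  simp [mulAct]

lemma mulAct_one (f₁ : Hp →ₐ[k] A₁) : mulAct ma2 f₁ 1 = LinearMap.id := by
  ext a b
  simp [Algebra.TensorProduct.one_def, ma2.act_one]

lemma mulAct_mul (f₁ : Hp →ₐ[k] A₁) (x y : Hp ⊗[k] Hm) :
    mulAct ma2 f₁ (x * y) = mulAct ma2 f₁ y ∘ₗ mulAct ma2 f₁ x := by
  induction x with
  | zero => simp
  | add x₁ x₂ h₁ h₂ => simp only [map_add, add_mul, h₁, h₂, LinearMap.comp_add]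
  | tmul g g' =>
    induction y with
    | zero => simp
    | add y₁ y₂ h₁ h₂ => simp only [map_add, mul_add, h₁, h₂, LinearMap.add_comp]
    | tmul l l' =>
      ext a b
      simp [ma2.act_mul, mul_assoc]

lemma mulAct_bijective (f₁ : Hp →ₐ[k] A₁) {x : Hp ⊗[k] Hm} (hx : IsUnit x) :
    Function.Bijective (mulAct ma2 f₁ x) := by
  obtain ⟨u, rfl⟩ := hx
  refine Function.bijective_iff_has_inverse.mpr ⟨mulAct ma2 f₁ (↑u⁻¹ : Hp ⊗[k] Hm), ?_, ?_⟩
  all_goals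
    intro z
    rw [← LinearMap.comp_apply, ← mulAct_mul]
    simp [mulAct_one]

/-- The unbraided multiplication map is the braided one precomposed with the action of `R`. -/
lemma mul_map_chiPlus (btp : BraidedTPModel k H Hp Hm A₁ A₂ C q ma1 ma2) (f₁ : Hp →ₐ[k] A₁) :
    LinearMap.mul' k C ∘ₗ TensorProduct.map btp.j₁.toLinearMap (chiPlus btp f₁) =
      (LinearMap.mul' k C ∘ₗ TensorProduct.map btp.j₁.toLinearMap btp.j₂.toLinearMap) ∘ₗ
        mulAct ma2 f₁ q.R := by
  ext a b
  simp only [TensorProduct.AlgebraTensorModule.curry_apply, LinearMap.restrictScalars_self,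
    TensorProduct.curry_apply, LinearMap.comp_apply, TensorProduct.map_tmul,
    LinearMap.mul'_apply, AlgHom.toLinearMap_apply, chiPlus, LinearMap.coe_mk, AddHom.coe_mk]
  induction q.R with
  | zero => simp
  | add x y hx hy => simp only [map_add, mul_add, LinearMap.add_apply, hx, hy]
  | tmul g g' => simp [mul_assoc]

/-- the `k`-linear map `A₁ ⊗ₖ A₂ → C`, `a₁ ⊗ a₂ ↦ j₁(a₁) · χ⁺(a₂)`,
is a linear isomorphism; in particular every element of `C` is a finite sum
`Σᵢ j₁(aᵢ) χ⁺(bᵢ)`, i.e. `C = j₁(A₁) · χ⁺(A₂)`. -/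
theorem unbraided_decomposition {k H Hp Hm A₁ A₂ C : Type*} [Field k] [Ring H] [Ring Hp]
    [Ring Hm] [Ring A₁] [Ring A₂] [Ring C] [HopfAlgebra k H] [HopfAlgebra k Hp]
    [HopfAlgebra k Hm] [Algebra k A₁] [Algebra k A₂] [Algebra k C]
    (q : QTSubData k H Hp Hm)
    (ma1 : RightModuleAlgebra k Hp A₁) (ma2 : RightModuleAlgebra k Hm A₂)
    (btp : BraidedTPModel k H Hp Hm A₁ A₂ C q ma1 ma2)
    (f₁ : Hp →ₐ[k] A₁) (hf₁ : IsRealization ma1 f₁) :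
    Function.Bijective
        ((LinearMap.mul' k C) ∘ₗ (TensorProduct.map btp.j₁.toLinearMap (chiPlus btp f₁))) ∧
      ∀ c : C, c ∈ Submodule.span k
        {x : C | ∃ (a₁ : A₁) (a₂ : A₂), x = btp.j₁ a₁ * chiPlus btp f₁ a₂} := by
  have hbij : Function.Bijective
      (LinearMap.mul' k C ∘ₗ TensorProduct.map btp.j₁.toLinearMap (chiPlus btp f₁)) := by
    rw [mul_map_chiPlus, LinearMap.coe_comp]
    exact btp.mul_bij.comp (mulAct_bijective f₁ q.isUnit_R)
  refine ⟨hbij, fun c => ?_⟩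
  obtain ⟨z, rfl⟩ := hbij.surjective c
  induction z with
  | zero => simp
  | add x y hx hy => rw [map_add]; exact add_mem hx hy
  | tmul a b => exact Submodule.subset_span ⟨a, b, rfl⟩
end
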